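/- Let 0 < k < N and let P ⊆ GL(N,ℂ) be the subgroup of invertible block upper triangular matrices (A B; 0 D) with A ∈ M_k(ℂ), B ∈ M_{k×(N−k)}(ℂ), D ∈ M_{N−k}(ℂ). Let χ : P → ℂ* be a group homomorphism such that the function (A,B,D) ↦ χ((A B; 0 D)) is holomorphic (complex differentiable) on the open subset of M_k(ℂ) × M_{k×(N−k)}(ℂ) × M_{N−k}(ℂ) where A and D are invertible. Then there exist integers m, n ∈ ℤ such that χ((A B; 0 D)) = (det A)^m (det D)^n for all (A B; 0 D) ∈ P. (Since the line bundles over Gr(k,N) correspond to such characters, this computes the Picard group of the Grassmannian.) -/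

import Mathlib

open Matrix

/-- A holomorphic character of the multiplicative group `ℂ \ {0}` is an integer power. -/
theorem exists_zpow_of_mul_of_differentiableAt (h : ℂ → ℂ)
    (hmul : ∀ z w, z ≠ 0 → w ≠ 0 → h (z * w) = h z * h w) (hne : h 1 ≠ 0)
    (hdiff : DifferentiableAt ℂ h 1) : ∃ a : ℤ, ∀ z, z ≠ 0 → h z = z ^ a := by
  have h1 : h 1 = 1 := by
    have := hmul 1 1 one_ne_zero one_ne_zero
    rw [one_mul] at this
    exact mul_left_cancel₀ hne (by rw [← this, mul_one])
  have gadd : ∀ s t, h (Complex.exp (s + t)) = h (Complex.exp s) * h (Complex.exp t) :=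
    fun s t ↦ by rw [Complex.exp_add, hmul _ _ (Complex.exp_ne_zero _) (Complex.exp_ne_zero _)]
  obtain ⟨c, hc⟩ : ∃ c, HasDerivAt (fun s ↦ h (Complex.exp s)) c 0 := by
    have hd : DifferentiableAt ℂ h (Complex.exp 0) := by rwa [Complex.exp_zero]
    exact ⟨_, (hd.comp (0 : ℂ) Complex.differentiableAt_exp).hasDerivAt⟩
  have hg : ∀ s, HasDerivAt (fun s ↦ h (Complex.exp s)) (h (Complex.exp s) * c) s := by
    intro s
    have hc' : HasDerivAt (fun s ↦ h (Complex.exp s)) c (s - s) := by rwa [sub_self]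
    have := (hc'.comp_sub_const s s).const_mul (h (Complex.exp s))
    refine this.congr_of_eventuallyEq (Filter.Eventually.of_forall fun x ↦ ?_)
    change h (Complex.exp x) = h (Complex.exp s) * h (Complex.exp (x - s))
    rw [← gadd, add_sub_cancel]
  have hconst : ∀ s, HasDerivAt (fun s ↦ h (Complex.exp s) * Complex.exp (-(c * s))) 0 s := by
    intro s
    have he := (((hasDerivAt_id s).const_mul c).neg).cexp
    exact ((hg s).mul he).congr_deriv (by simp; ring)
  have hexp : ∀ s, h (Complex.exp s) = Complex.exp (c * s) := by
    intro s
    have := is_const_of_deriv_eq_zero (fun x ↦ (hconst x).differentiableAt)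
      (fun x ↦ (hconst x).deriv) s 0
    simp only [Complex.exp_zero, h1, mul_zero, neg_zero, mul_one, Complex.exp_neg] at this
    exact eq_of_mul_inv_eq_one this
  have hper := hexp (2 * Real.pi * Complex.I)
  rw [Complex.exp_two_pi_mul_I, h1] at hper
  obtain ⟨n, hn⟩ := Complex.exp_eq_one_iff.1 hper.symm
  have hcn : c = n := mul_right_cancel₀ Complex.two_pi_I_ne_zero hn
  refine ⟨n, fun z hz ↦ ?_⟩
  conv_lhs => rw [← Complex.exp_log hz]
  rw [hexp, hcn, Complex.exp_int_mul, Complex.exp_log hz]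

section GeneralLinear

variable {ι : Type*} [Fintype ι] [DecidableEq ι]

theorem Matrix.diagonal_update_mul_transvection (i j : ι) (hij : i ≠ j) (t c : ℂ) :
    diagonal (Function.update 1 i t) * transvection i j c =
      transvection i j (t * c) * diagonal (Function.update 1 i t) := by
  simp only [transvection, Matrix.mul_add, Matrix.add_mul, mul_one, one_mul]
  congr 1
  ext a b
  rw [diagonal_mul, mul_diagonal]
  by_cases ha : i = a
  · by_cases hb : j = b
    · subst ha hb
      simp [Function.update_of_ne hij.symm]
    · simp [hb]
  · simp [ha]

theorem Matrix.swap_mul_diagonal_update (i j : ι) (t : ℂ) :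
    swap ℂ i j * diagonal (Function.update 1 j t) =
      diagonal (Function.update 1 i t) * swap ℂ i j := by
  ext a b
  rw [mul_diagonal, diagonal_mul]
  simp only [swap, Equiv.Perm.permMatrix, PEquiv.toMatrix_apply, Equiv.toPEquiv_apply,
    Option.mem_def, Option.some.injEq, Function.update_apply, Pi.one_apply]
  by_cases hab : Equiv.swap i j a = b
  · subst hab
    have : Equiv.swap i j a = j ↔ a = i := by
      rw [Equiv.swap_apply_eq_iff, Equiv.swap_apply_right]
    simp [this]
  · simp [hab]

theorem Matrix.isUnit_det_diagonal_update (i : ι) {t : ℂ} (ht : t ≠ 0) :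
    IsUnit (diagonal (Function.update (1 : ι → ℂ) i t)).det := by
  rw [det_diagonal, isUnit_iff_ne_zero, Finset.prod_ne_zero_iff]
  intro j _
  by_cases hj : j = i
  · subst hj; simpa using ht
  · simp [hj]

variable {f : Matrix ι ι ℂ → ℂ}

theorem Matrix.map_one_of_mul
    (hmul : ∀ A A', IsUnit A.det → IsUnit A'.det → f (A * A') = f A * f A')
    (hne : ∀ A, IsUnit A.det → f A ≠ 0) : f 1 = 1 := by
  have h1 : IsUnit (1 : Matrix ι ι ℂ).det := by simp
  have := hmul 1 1 h1 h1
  rw [one_mul] at this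
  exact mul_left_cancel₀ (hne 1 h1) (by rw [← this, mul_one])

theorem Matrix.map_transvection_of_mul
    (hmul : ∀ A A', IsUnit A.det → IsUnit A'.det → f (A * A') = f A * f A')
    (hne : ∀ A, IsUnit A.det → f A ≠ 0) {i j : ι} (hij : i ≠ j) (c : ℂ) :
    f (transvection i j c) = 1 := by
  have ht : ∀ c : ℂ, IsUnit (transvection i j c).det := fun c ↦ by
    simp [det_transvection_of_ne i j hij c]
  have hd := isUnit_det_diagonal_update i (two_ne_zero (α := ℂ))
  have h := congrArg f (diagonal_update_mul_transvection i j hij 2 c)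
  rw [hmul _ _ hd (ht _), hmul _ _ (ht _) hd, two_mul c,
    ← transvection_mul_transvection_same i j hij, hmul _ _ (ht _) (ht _), mul_comm] at h
  have h' := mul_right_cancel₀ (hne _ hd) h
  exact mul_left_cancel₀ (hne _ (ht c)) (by rw [← h', mul_one])

theorem Matrix.map_diagonal_update_of_mul
    (hmul : ∀ A A', IsUnit A.det → IsUnit A'.det → f (A * A') = f A * f A')
    (hne : ∀ A, IsUnit A.det → f A ≠ 0) (i j : ι) {t : ℂ} (ht : t ≠ 0) :
    f (diagonal (Function.update 1 j t)) = f (diagonal (Function.update 1 i t)) := by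
  have hs : IsUnit (swap ℂ i j).det := by
    rw [swap, det_permutation]
    rcases Int.units_eq_one_or (Equiv.Perm.sign (Equiv.swap i j)) with h | h <;> simp [h]
  have h := congrArg f (swap_mul_diagonal_update i j t)
  rw [hmul _ _ hs (isUnit_det_diagonal_update j ht),
    hmul _ _ (isUnit_det_diagonal_update i ht) hs, mul_comm] at h
  exact mul_right_cancel₀ (hne _ hs) h

theorem Matrix.map_diagonal_of_mul
    (hmul : ∀ A A', IsUnit A.det → IsUnit A'.det → f (A * A') = f A * f A')
    (hne : ∀ A, IsUnit A.det → f A ≠ 0) (d : ι → ℂ) (hd : ∀ i, d i ≠ 0) :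
    f (diagonal d) = ∏ i, f (diagonal (Function.update 1 i (d i))) := by
  have key : ∀ s : Finset ι, f (diagonal (fun j ↦ if j ∈ s then d j else 1)) =
      ∏ i ∈ s, f (diagonal (Function.update 1 i (d i))) := by
    intro s
    induction s using Finset.induction_on with
    | empty => simpa using map_one_of_mul hmul hne
    | insert i s hi ih =>
      rw [Finset.prod_insert hi, ← ih, ← hmul _ _ (isUnit_det_diagonal_update i (hd i)),
        diagonal_mul_diagonal]
      · congr 2
        ext j
        by_cases hj : j = i
        · subst hj; simp [hi]
        · simp [hj]
      · rw [det_diagonal, isUnit_iff_ne_zero, Finset.prod_ne_zero_iff]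
        intro j _
        split_ifs
        · exact hd j
        · exact one_ne_zero
  simpa using key Finset.univ

/-- A character of `GL(ι,ℂ)` that is complex differentiable at the identity is an integer power of
the determinant. -/
theorem Matrix.exists_det_zpow_of_mul [Nonempty ι]
    (hmul : ∀ A A', IsUnit A.det → IsUnit A'.det → f (A * A') = f A * f A')
    (hne : ∀ A, IsUnit A.det → f A ≠ 0)
    (hdiff : DifferentiableAt ℂ (fun p : ι → ι → ℂ ↦ f (Matrix.of p))
      (fun i j ↦ (1 : Matrix ι ι ℂ) i j)) :
    ∃ a : ℤ, ∀ A, IsUnit A.det → f A = A.det ^ a := by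
  obtain ⟨i⟩ := ‹Nonempty ι›
  have hone : diagonal (Function.update (1 : ι → ℂ) i 1) = 1 := by
    rw [← Pi.one_apply (M := fun _ ↦ ℂ) i, Function.update_eq_self]
    exact diagonal_one
  have hcurve : DifferentiableAt ℂ
      (fun t : ℂ ↦ (fun a b ↦ diagonal (Function.update (1 : ι → ℂ) i t) a b : ι → ι → ℂ)) 1 := by
    refine differentiableAt_pi.2 fun a ↦ differentiableAt_pi.2 fun b ↦ ?_
    simp only [diagonal_apply, Function.update_apply]
    split_ifs <;> fun_prop
  obtain ⟨a, ha⟩ := exists_zpow_of_mul_of_differentiableAt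
    (fun t ↦ f (diagonal (Function.update 1 i t)))
    (fun z w hz hw ↦ by
      rw [← hmul _ _ (isUnit_det_diagonal_update i hz) (isUnit_det_diagonal_update i hw),
        diagonal_mul_diagonal]
      congr 2
      ext j
      by_cases hj : j = i
      · subst hj; simp
      · simp [hj])
    (hne _ (isUnit_det_diagonal_update i one_ne_zero))
    (by
      refine DifferentiableAt.comp (1 : ℂ) (g := fun p : ι → ι → ℂ ↦ f (Matrix.of p)) ?_ hcurve
      change DifferentiableAt ℂ _ (diagonal (Function.update (1 : ι → ℂ) i 1))
      rw [hone]
      exact hdiff)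
  refine ⟨a, fun A hA ↦ ?_⟩
  refine diagonal_transvection_induction_of_det_ne_zero (fun A ↦ f A = A.det ^ a) A hA.ne_zero
    (fun d hd ↦ ?_) (fun t ↦ ?_) (fun A B hA hB hfA hfB ↦ ?_)
  · rw [det_diagonal, Finset.prod_ne_zero_iff] at hd
    have hd' : ∀ j, d j ≠ 0 := fun j ↦ hd j (Finset.mem_univ j)
    rw [map_diagonal_of_mul hmul hne d hd', det_diagonal, ← Finset.prod_zpow]
    exact Finset.prod_congr rfl fun j _ ↦ by
      rw [map_diagonal_update_of_mul hmul hne i j (hd' j), ha _ (hd' j)]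
  · rw [TransvectionStruct.det, _root_.one_zpow]
    exact map_transvection_of_mul hmul hne t.hij t.c
  · rw [hmul A B (isUnit_iff_ne_zero.2 hA) (isUnit_iff_ne_zero.2 hB), hfA, hfB, det_mul, mul_zpow]

end GeneralLinear



/-- Every holomorphic character of the parabolic subgroup `P ⊆ GL(N,ℂ)` of invertible
block upper triangular matrices `(A B; 0 D)` is of the form `(det A)^m (det D)^n` for
integers `m, n`: this computes the Picard group of the Grassmannian `Gr(k,N)`. -/
theorem stmt_13 (k m : ℕ) (hk : 0 < k) (hm : 0 < m)
    (χ : Matrix (Fin k ⊕ Fin m) (Fin k ⊕ Fin m) ℂ → ℂ)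
    (hmul : ∀ (A A' : Matrix (Fin k) (Fin k) ℂ) (B B' : Matrix (Fin k) (Fin m) ℂ)
      (D D' : Matrix (Fin m) (Fin m) ℂ),
      IsUnit A.det → IsUnit D.det → IsUnit A'.det → IsUnit D'.det →
      χ (Matrix.fromBlocks A B 0 D * Matrix.fromBlocks A' B' 0 D') =
        χ (Matrix.fromBlocks A B 0 D) * χ (Matrix.fromBlocks A' B' 0 D'))
    (hne : ∀ (A : Matrix (Fin k) (Fin k) ℂ) (B : Matrix (Fin k) (Fin m) ℂ)
      (D : Matrix (Fin m) (Fin m) ℂ), IsUnit A.det → IsUnit D.det →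
      χ (Matrix.fromBlocks A B 0 D) ≠ 0)
    (hhol : DifferentiableOn ℂ
      (fun p : (Fin k → Fin k → ℂ) × (Fin k → Fin m → ℂ) × (Fin m → Fin m → ℂ) =>
        χ (Matrix.fromBlocks (Matrix.of p.1) (Matrix.of p.2.1) 0 (Matrix.of p.2.2)))
      {p : (Fin k → Fin k → ℂ) × (Fin k → Fin m → ℂ) × (Fin m → Fin m → ℂ) |
        IsUnit (Matrix.of p.1).det ∧ IsUnit (Matrix.of p.2.2).det}) :
    ∃ a b : ℤ, ∀ (A : Matrix (Fin k) (Fin k) ℂ) (B : Matrix (Fin k) (Fin m) ℂ)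
      (D : Matrix (Fin m) (Fin m) ℂ), IsUnit A.det → IsUnit D.det →
      χ (Matrix.fromBlocks A B 0 D) = A.det ^ a * D.det ^ b := by
  have : Nonempty (Fin k) := ⟨⟨0, hk⟩⟩
  have : Nonempty (Fin m) := ⟨⟨0, hm⟩⟩
  have u1 : ∀ n : ℕ, IsUnit (1 : Matrix (Fin n) (Fin n) ℂ).det := fun n ↦ by simp
  have hopen : IsOpen {p : (Fin k → Fin k → ℂ) × (Fin k → Fin m → ℂ) × (Fin m → Fin m → ℂ) |
      IsUnit (Matrix.of p.1).det ∧ IsUnit (Matrix.of p.2.2).det} := by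
    simp only [isUnit_iff_ne_zero]
    refine IsOpen.inter (isOpen_ne_fun ?_ continuous_const) (isOpen_ne_fun ?_ continuous_const)
    · exact Continuous.matrix_det (A := fun p : (Fin k → Fin k → ℂ) × (Fin k → Fin m → ℂ) ×
        (Fin m → Fin m → ℂ) ↦ Matrix.of p.1) continuous_fst
    · exact Continuous.matrix_det (A := fun p : (Fin k → Fin k → ℂ) × (Fin k → Fin m → ℂ) ×
        (Fin m → Fin m → ℂ) ↦ Matrix.of p.2.2) (continuous_snd.comp continuous_snd)
  have hat := hhol.differentiableAt (hopen.mem_nhds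
    (x := (fun i j ↦ (1 : Matrix (Fin k) (Fin k) ℂ) i j, fun _ _ ↦ 0,
      fun i j ↦ (1 : Matrix (Fin m) (Fin m) ℂ) i j)) ⟨u1 k, u1 m⟩)
  obtain ⟨a, ha⟩ := Matrix.exists_det_zpow_of_mul (f := fun A ↦ χ (fromBlocks A 0 0 1))
    (fun A A' hA hA' ↦ by rw [← hmul A A' 0 0 1 1 hA (u1 m) hA' (u1 m)]; simp [fromBlocks_multiply])
    (fun A hA ↦ hne A 0 1 hA (u1 m))
    (hat.comp (fun i j ↦ (1 : Matrix (Fin k) (Fin k) ℂ) i j)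
      (f := fun p : Fin k → Fin k → ℂ ↦ (p, (fun _ _ ↦ 0 : Fin k → Fin m → ℂ),
        (fun i j ↦ (1 : Matrix (Fin m) (Fin m) ℂ) i j : Fin m → Fin m → ℂ))) (by fun_prop))
  obtain ⟨b, hb⟩ := Matrix.exists_det_zpow_of_mul (f := fun D ↦ χ (fromBlocks 1 0 0 D))
    (fun D D' hD hD' ↦ by rw [← hmul 1 1 0 0 D D' (u1 k) hD (u1 k) hD']; simp [fromBlocks_multiply])
    (fun D hD ↦ hne 1 0 D (u1 k) hD)
    (hat.comp (fun i j ↦ (1 : Matrix (Fin m) (Fin m) ℂ) i j)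
      (f := fun p : Fin m → Fin m → ℂ ↦
        ((fun i j ↦ (1 : Matrix (Fin k) (Fin k) ℂ) i j : Fin k → Fin k → ℂ),
          (fun _ _ ↦ 0 : Fin k → Fin m → ℂ), p)) (by fun_prop))
  have hB : ∀ B : Matrix (Fin k) (Fin m) ℂ, χ (fromBlocks 1 B 0 1) = 1 := by
    intro B
    have u2 : IsUnit ((2 : ℂ) • (1 : Matrix (Fin k) (Fin k) ℂ)).det := by simp
    have hsq : χ (fromBlocks 1 (B + B) 0 1) = χ (fromBlocks 1 B 0 1) * χ (fromBlocks 1 B 0 1) := by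
      rw [← hmul 1 1 B B 1 1 (u1 k) (u1 m) (u1 k) (u1 m)]
      simp [fromBlocks_multiply]
    have hconj : fromBlocks ((2 : ℂ) • (1 : Matrix (Fin k) (Fin k) ℂ)) 0 0 1 * fromBlocks 1 B 0 1 =
        fromBlocks 1 (B + B) 0 1 * fromBlocks ((2 : ℂ) • (1 : Matrix (Fin k) (Fin k) ℂ)) 0 0
          (1 : Matrix (Fin m) (Fin m) ℂ) := by
      simp [fromBlocks_multiply, two_smul, Matrix.add_mul]
    have h := congrArg χ hconj
    rw [hmul _ _ _ _ _ _ u2 (u1 m) (u1 k) (u1 m), hmul _ _ _ _ _ _ (u1 k) (u1 m) u2 (u1 m),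
      mul_comm] at h
    have h' := mul_right_cancel₀ (hne _ 0 1 u2 (u1 m)) h
    rw [← h'] at hsq
    exact mul_left_cancel₀ (hne 1 B 1 (u1 k) (u1 m)) (by rw [← hsq, mul_one])
  refine ⟨a, b, fun A B D hA hD ↦ ?_⟩
  have hfac : fromBlocks A B 0 D =
      fromBlocks A 0 0 D * fromBlocks 1 (A⁻¹ * B) 0 (1 : Matrix (Fin m) (Fin m) ℂ) := by
    simp [fromBlocks_multiply, mul_nonsing_inv_cancel_left _ _ hA]
  have hdiag : fromBlocks A 0 0 D = fromBlocks A (0 : Matrix (Fin k) (Fin m) ℂ) 0 1 *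
      fromBlocks 1 0 0 D := by
    simp [fromBlocks_multiply]
  rw [hfac, hmul _ _ _ _ _ _ hA hD (u1 k) (u1 m), hB, mul_one, hdiag,
    hmul _ _ _ _ _ _ hA (u1 m) (u1 k) hD]
  exact congrArg₂ (· * ·) (ha A hA) (hb D hD)
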